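/- Let H₁, H₂ ∈ (0,1) and let θ ∈ ℝ satisfy √|θ| < min over i ∈ {1,2} of (Γ(2H_i)/Γ(H_i)²)·((1 − H_i)/(4H_i))·sin(πH_i)·tanh(πH_i). Then the kernel (u,v) ↦ R_θ(u − v) is positive semidefinite on ℝ² × ℝ²: for every n ∈ ℕ, every family of points v¹, …, vⁿ ∈ ℝ², and every c₁, …, cₙ ∈ ℝ, one has Σ_{i=1}^{n} Σ_{j=1}^{n} c_i·c_j·R_θ(vⁱ − vʲ) ≥ 0. -/

import Mathlib

open Real

/-- `F_H(v) = 2 cosh(Hv) - |2 sinh(v/2)|^{2H}`. -/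
noncomputable def Ffun (H v : ℝ) : ℝ :=
  2 * Real.cosh (H * v) - |2 * Real.sinh (v / 2)| ^ (2 * H)

/-- `R_θ(v₁,v₂) = (1/4) F_{H₁}(v₁) F_{H₂}(v₂)
  (1 + θ e^{−H₁|v₁| − H₂|v₂|} sinh(H₁v₁) sinh(H₂v₂))`. -/
noncomputable def Rtheta (H₁ H₂ θ v₁ v₂ : ℝ) : ℝ :=
  (1 / 4) * Ffun H₁ v₁ * Ffun H₂ v₂
    * (1 + θ * Real.exp (-(H₁ * |v₁|) - H₂ * |v₂|)
        * Real.sinh (H₁ * v₁) * Real.sinh (H₂ * v₂))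

open scoped FourierTransform ComplexConjugate ComplexOrder
open MeasureTheory

/-- `K` is the inverse Fourier transform of the integrable density `ρ`. -/
def IsSpectralDensity (K : ℝ → ℂ) (ρ : ℝ → ℝ) : Prop :=
  Integrable ρ ∧ ∀ v, K v = ∫ x : ℝ, (ρ x : ℂ) * Complex.exp ((2 * π * (x * v) : ℝ) * Complex.I)

/-- Positive definite functions on the line. -/
def IsPosDefFun (K : ℝ → ℂ) : Prop :=
  ∀ (n : ℕ) (v : Fin n → ℝ), (Matrix.of fun i j => K (v i - v j)).PosSemidef

lemma integrable_ofReal_mul_cexp {ρ : ℝ → ℝ} (h : Integrable ρ) (v : ℝ) :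
    Integrable fun x : ℝ => (ρ x : ℂ) * Complex.exp ((2 * π * (x * v) : ℝ) * Complex.I) := by
  refine (h.ofReal (𝕜 := ℂ)).mul_bdd (c := 1) (by fun_prop) (ae_of_all _ fun x => ?_)
  rw [Complex.norm_exp_ofReal_mul_I]

lemma IsSpectralDensity.add {K L : ℝ → ℂ} {ρ σ : ℝ → ℝ} (hK : IsSpectralDensity K ρ)
    (hL : IsSpectralDensity L σ) :
    IsSpectralDensity (fun v => K v + L v) (fun x => ρ x + σ x) := by
  refine ⟨hK.1.add hL.1, fun v => ?_⟩
  simp only [hK.2 v, hL.2 v]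
  rw [← integral_add (integrable_ofReal_mul_cexp hK.1 v) (integrable_ofReal_mul_cexp hL.1 v)]
  simp [add_mul]

lemma IsSpectralDensity.const_mul {K : ℝ → ℂ} {ρ : ℝ → ℝ} (hK : IsSpectralDensity K ρ) (c : ℝ) :
    IsSpectralDensity (fun v => c * K v) (fun x => c * ρ x) := by
  refine ⟨hK.1.const_mul c, fun v => ?_⟩
  simp only [hK.2 v]
  rw [← integral_const_mul]
  simp [mul_assoc]

lemma IsSpectralDensity.zero : IsSpectralDensity (fun _ => 0) (fun _ => 0) :=
  ⟨integrable_zero _ _ _, by simp⟩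

lemma IsSpectralDensity.sum {K : ℕ → ℝ → ℂ} {ρ : ℕ → ℝ → ℝ}
    (h : ∀ k, IsSpectralDensity (K k) (ρ k)) (N : ℕ) :
    IsSpectralDensity (fun v => ∑ k ∈ Finset.range N, K k v)
      (fun x => ∑ k ∈ Finset.range N, ρ k x) := by
  induction N with
  | zero => simpa using IsSpectralDensity.zero
  | succ N ih => simpa only [Finset.sum_range_succ] using ih.add (h N)

lemma IsSpectralDensity.isPosDefFun {K : ℝ → ℂ} {ρ : ℝ → ℝ} (h : IsSpectralDensity K ρ)
    (hρ : ∀ x, 0 ≤ ρ x) : IsPosDefFun K := by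
  intro n v
  refine Matrix.PosSemidef.of_dotProduct_mulVec_nonneg ?_ fun z => ?_
  · ext i j
    simp only [Matrix.conjTranspose_apply, Matrix.of_apply, h.2, RCLike.star_def]
    rw [← integral_conj]
    congr 1 with x
    simp only [map_mul, Complex.conj_ofReal, ← Complex.exp_conj, Complex.conj_I]
    push_cast
    ring_nf
  · have key : star z ⬝ᵥ ((Matrix.of fun i j => K (v i - v j)).mulVec z)
        = ((∫ x : ℝ, ρ x * Complex.normSq
            (∑ j, z j * Complex.exp (-(2 * π * (x * v j) : ℝ) * Complex.I)) : ℝ) : ℂ) := by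
      simp only [dotProduct, Matrix.mulVec, Matrix.of_apply, Pi.star_apply, h.2, Finset.mul_sum]
      rw [← integral_complex_ofReal]
      have : ∀ i j, star (z i) * ((∫ x : ℝ, (ρ x : ℂ) *
            Complex.exp ((2 * π * (x * (v i - v j)) : ℝ) * Complex.I)) * z j)
          = ∫ x : ℝ, star (z i) * ((ρ x : ℂ) *
            Complex.exp ((2 * π * (x * (v i - v j)) : ℝ) * Complex.I) * z j) := by
        intro i j
        rw [integral_const_mul, integral_mul_const]
      simp only [this]
      have hint : ∀ i j, Integrable fun x : ℝ => star (z i) * ((ρ x : ℂ) *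
            Complex.exp ((2 * π * (x * (v i - v j)) : ℝ) * Complex.I) * z j) := fun i j =>
        ((integrable_ofReal_mul_cexp h.1 _).mul_const _).const_mul _
      rw [Finset.sum_congr rfl fun i _ => (integral_finsetSum _ fun j _ => hint i j).symm,
        ← integral_finsetSum _ fun i _ => integrable_finsetSum _ fun j _ => hint i j]
      congr 1 with x
      rw [Complex.ofReal_mul, Complex.normSq_eq_conj_mul_self, map_sum,
        Finset.sum_mul_sum, Finset.mul_sum]
      refine Finset.sum_congr rfl fun i _ => ?_
      rw [Finset.mul_sum]
      refine Finset.sum_congr rfl fun j _ => ?_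
      have he : Complex.exp ((2 * π * (x * (v i - v j)) : ℝ) * Complex.I)
          = conj (Complex.exp (-(2 * π * (x * v i) : ℝ) * Complex.I))
            * Complex.exp (-(2 * π * (x * v j) : ℝ) * Complex.I) := by
        rw [← Complex.exp_conj, ← Complex.exp_add]
        congr 1
        simp only [map_mul, map_neg, Complex.conj_ofReal, Complex.conj_I]
        push_cast
        ring
      rw [he, map_mul, RCLike.star_def]
      ring
    rw [key]
    exact Complex.zero_le_real.2 (integral_nonneg fun x =>
      mul_nonneg (hρ x) (Complex.normSq_nonneg _))

lemma IsPosDefFun.of_tendsto {K : ℕ → ℝ → ℂ} {L : ℝ → ℂ} (hK : ∀ N, IsPosDefFun (K N))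
    (h : ∀ v, Filter.Tendsto (fun N => K N v) Filter.atTop (nhds (L v))) : IsPosDefFun L := by
  intro n v
  refine Matrix.PosSemidef.of_dotProduct_mulVec_nonneg ?_ fun z => ?_
  · ext i j
    refine tendsto_nhds_unique ((h (v j - v i)).star) ?_
    refine (h (v i - v j)).congr fun N => ?_
    exact congrFun (congrFun (hK N n v).1 i) j |>.symm
  · have ht : Filter.Tendsto
        (fun N => star z ⬝ᵥ ((Matrix.of fun i j => K N (v i - v j)).mulVec z)) Filter.atTop
        (nhds (star z ⬝ᵥ ((Matrix.of fun i j => L (v i - v j)).mulVec z))) := by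
      simp only [dotProduct, Matrix.mulVec, Matrix.of_apply]
      exact tendsto_finsetSum _ fun i _ => Filter.Tendsto.const_mul _
        (tendsto_finsetSum _ fun j _ => (h _).mul_const _)
    exact ge_of_tendsto' ht fun N => (hK N n v).dotProduct_mulVec_nonneg z

/-- The exponential kernel `e^{-μ|v|}` modulated by `1 + i a e^{-H|v|} sinh (H v)`. -/
noncomputable def modExpKernel (H a μ v : ℝ) : ℂ :=
  (Real.exp (-(μ * |v|)) : ℂ) * (1 + ((a * (Real.exp (-(H * |v|)) * Real.sinh (H * v)) : ℝ) : ℂ)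
    * Complex.I)

/-- The Fourier transform of `modExpKernel H a μ`, in the angular frequency. -/
noncomputable def modExpDensity (H a μ ω : ℝ) : ℝ :=
  2 * μ / (μ ^ 2 + ω ^ 2) + a * (ω / (μ ^ 2 + ω ^ 2) - ω / ((μ + 2 * H) ^ 2 + ω ^ 2))

lemma modExpKernel_of_nonneg (H a μ : ℝ) {v : ℝ} (hv : 0 ≤ v) :
    modExpKernel H a μ v = (1 + a / 2 * Complex.I) * Complex.exp (-μ * v)
      - (a / 2 * Complex.I) * Complex.exp (-(μ + 2 * H) * v) := by
  have h1 : Complex.exp (-(μ + 2 * H) * v) = Complex.exp (-μ * v) * Complex.exp (-(H * v))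
      * Complex.exp (-(H * v)) := by
    rw [← Complex.exp_add, ← Complex.exp_add]; congr 1; ring
  have h2 : Complex.exp (H * v) * Complex.exp (-(H * v)) = 1 := by
    rw [← Complex.exp_add]; simp
  rw [modExpKernel, abs_of_nonneg hv, Real.sinh_eq, h1]
  push_cast
  rw [show (-(μ * v) : ℂ) = -μ * v by ring]
  linear_combination (Complex.exp (-μ * v) * a / 2 * Complex.I) * h2

lemma modExpKernel_of_nonpos (H a μ : ℝ) {v : ℝ} (hv : v ≤ 0) :
    modExpKernel H a μ v = (1 - a / 2 * Complex.I) * Complex.exp (μ * v)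
      + (a / 2 * Complex.I) * Complex.exp ((μ + 2 * H) * v) := by
  have h1 : Complex.exp ((μ + 2 * H) * v) = Complex.exp (μ * v) * Complex.exp (H * v)
      * Complex.exp (H * v) := by
    rw [← Complex.exp_add, ← Complex.exp_add]; congr 1; ring
  have h2 : Complex.exp (H * v) * Complex.exp (-(H * v)) = 1 := by
    rw [← Complex.exp_add]; simp
  rw [modExpKernel, abs_of_nonpos hv, Real.sinh_eq, h1]
  push_cast
  rw [show (-(μ * -v) : ℂ) = μ * v by ring, show (-(H * -v) : ℂ) = H * v by ring]
  linear_combination (-Complex.exp (μ * v) * a / 2 * Complex.I) * h2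

lemma continuous_modExpKernel (H a μ : ℝ) : Continuous (modExpKernel H a μ) := by
  unfold modExpKernel
  fun_prop

lemma integrable_const_div_sq_add_sq {μ : ℝ} (hμ : 0 < μ) :
    Integrable fun x : ℝ => (μ ^ 2 + (2 * π * x) ^ 2)⁻¹ := by
  have h := (integrable_inv_one_add_sq.comp_mul_left' (R := 2 * π / μ) (by positivity)).const_mul
    (μ ^ 2)⁻¹
  refine h.congr (ae_of_all _ fun x => ?_)
  simp only
  rw [← mul_inv]
  congr 1
  field_simp

lemma abs_div_sq_add_sq_le {ν : ℝ} (hν : 0 < ν) (ω : ℝ) :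
    |ω / (ν ^ 2 + ω ^ 2)| ≤ 1 / (2 * ν) := by
  rw [abs_div, abs_of_pos (show 0 < ν ^ 2 + ω ^ 2 by positivity),
    div_le_div_iff₀ (by positivity) (by positivity)]
  nlinarith [sq_nonneg (ν - |ω|), sq_abs ω]

lemma integrable_modExpDensity {H μ : ℝ} (a : ℝ) (hH : 0 < H) (hμ : 0 < μ) :
    Integrable fun x : ℝ => modExpDensity H a μ (2 * π * x) := by
  have h := (integrable_const_div_sq_add_sq hμ).bdd_mul
    (c := 2 * μ + |a * (4 * H * (μ + H))| * (1 / (2 * (μ + 2 * H))))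
    (f := fun x : ℝ => 2 * μ + a * (4 * H * (μ + H)) *
      ((2 * π * x) / ((μ + 2 * H) ^ 2 + (2 * π * x) ^ 2))) ?_ (ae_of_all _ fun x => ?_)
  · refine h.congr (ae_of_all _ fun x => ?_)
    have h1 : μ ^ 2 + (2 * π * x) ^ 2 ≠ 0 := by positivity
    have h2 : (μ + 2 * H) ^ 2 + (2 * π * x) ^ 2 ≠ 0 := by positivity
    simp only [modExpDensity]
    generalize 2 * π * x = ω at *
    field_simp
    ring
  · have : ∀ x : ℝ, (μ + 2 * H) ^ 2 + (2 * π * x) ^ 2 ≠ 0 := fun x => by positivity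
    exact (by fun_prop (disch := assumption) : Continuous _).aestronglyMeasurable
  · rw [Real.norm_eq_abs]
    refine (abs_add_le _ _).trans ?_
    rw [abs_of_pos (show 0 < 2 * μ by positivity), abs_mul]
    gcongr
    exact abs_div_sq_add_sq_le (by positivity) _

lemma fourier_modExpKernel {H μ : ℝ} (a : ℝ) (hH : 0 < H) (hμ : 0 < μ) :
    Integrable (modExpKernel H a μ) ∧
      ∀ x, 𝓕 (modExpKernel H a μ) x = (modExpDensity H a μ (2 * π * x) : ℂ) := by
  have hre' : ∀ {c : ℝ} (x : ℝ), ((c : ℂ) - (2 * π * x : ℝ) * Complex.I).re = c := by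
    intro c x; simp
  have hν : 0 < μ + 2 * H := by positivity
  have hpos : ∀ x : ℝ, Set.EqOn
      (fun v : ℝ => Complex.exp ((-2 * π * v * x : ℝ) * Complex.I) * modExpKernel H a μ v)
      (fun v : ℝ => (1 + a / 2 * Complex.I) *
          Complex.exp (((-μ : ℝ) - (2 * π * x : ℝ) * Complex.I) * v)
        - (a / 2 * Complex.I) *
          Complex.exp (((-(μ + 2 * H) : ℝ) - (2 * π * x : ℝ) * Complex.I) * v))
      (Set.Ioi 0) := by
    intro x v hv
    simp only
    rw [modExpKernel_of_nonneg H a μ (le_of_lt hv), mul_sub, mul_left_comm, mul_left_comm _ (_ * _),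
      ← Complex.exp_add, ← Complex.exp_add]
    push_cast
    congr 3 <;> ring
  have hneg : ∀ x : ℝ, Set.EqOn
      (fun v : ℝ => Complex.exp ((-2 * π * v * x : ℝ) * Complex.I) * modExpKernel H a μ v)
      (fun v : ℝ => (1 - a / 2 * Complex.I) *
          Complex.exp (((μ : ℝ) - (2 * π * x : ℝ) * Complex.I) * v)
        + (a / 2 * Complex.I) *
          Complex.exp ((((μ + 2 * H) : ℝ) - (2 * π * x : ℝ) * Complex.I) * v))
      (Set.Iic 0) := by
    intro x v hv
    simp only
    rw [modExpKernel_of_nonpos H a μ hv, mul_add, mul_left_comm, mul_left_comm _ (_ * _),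
      ← Complex.exp_add, ← Complex.exp_add]
    push_cast
    congr 3 <;> ring
  have ip : ∀ {c : ℝ} (x : ℝ), 0 < c → IntegrableOn
      (fun v : ℝ => Complex.exp (((-c : ℝ) - (2 * π * x : ℝ) * Complex.I) * v)) (Set.Ioi 0) :=
    fun x hc => integrableOn_exp_mul_complex_Ioi (by rw [hre']; linarith) 0
  have im : ∀ {c : ℝ} (x : ℝ), 0 < c → IntegrableOn
      (fun v : ℝ => Complex.exp (((c : ℝ) - (2 * π * x : ℝ) * Complex.I) * v)) (Set.Iic 0) :=
    fun x hc => integrableOn_exp_mul_complex_Iic (by rw [hre']; linarith) 0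
  have hIp : ∀ x : ℝ, IntegrableOn
      (fun v : ℝ => Complex.exp ((-2 * π * v * x : ℝ) * Complex.I) * modExpKernel H a μ v)
      (Set.Ioi 0) := fun x =>
    (integrableOn_congr_fun (hpos x) measurableSet_Ioi).2
      (((ip x hμ).const_mul _).sub ((ip x hν).const_mul _))
  have hIm : ∀ x : ℝ, IntegrableOn
      (fun v : ℝ => Complex.exp ((-2 * π * v * x : ℝ) * Complex.I) * modExpKernel H a μ v)
      (Set.Iic 0) := fun x =>
    (integrableOn_congr_fun (hneg x) measurableSet_Iic).2
      (((im x hμ).const_mul _).add ((im x hν).const_mul _))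
  constructor
  · have h := (hIm 0).union (hIp 0)
    rw [Set.Iic_union_Ioi, integrableOn_univ] at h
    simpa using h
  · intro x
    rw [Real.fourier_eq']
    have hinner : ∀ v : ℝ, Complex.exp (((-2 * π * inner ℝ v x : ℝ) : ℂ) * Complex.I) •
        modExpKernel H a μ v
        = Complex.exp ((-2 * π * v * x : ℝ) * Complex.I) * modExpKernel H a μ v := by
      intro v
      rw [smul_eq_mul]
      congr 4
      simp; ring
    simp only [hinner]
    rw [← intervalIntegral.integral_Iic_add_Ioi (hIm x) (hIp x),
      setIntegral_congr_fun measurableSet_Iic (hneg x),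
      setIntegral_congr_fun measurableSet_Ioi (hpos x),
      integral_add ((im x hμ).const_mul _) ((im x hν).const_mul _),
      integral_sub ((ip x hμ).const_mul _) ((ip x hν).const_mul _)]
    simp only [integral_const_mul]
    rw [integral_exp_mul_complex_Iic (by rw [hre']; linarith),
      integral_exp_mul_complex_Iic (by rw [hre']; linarith),
      integral_exp_mul_complex_Ioi (by rw [hre']; linarith),
      integral_exp_mul_complex_Ioi (by rw [hre']; linarith)]
    simp only [Complex.ofReal_zero, mul_zero, Complex.exp_zero, modExpDensity]
    generalize 2 * π * x = ω
    have hne : ∀ {c : ℝ}, 0 < c → (c : ℂ) - ω * Complex.I ≠ 0 ∧ ((-c : ℝ) : ℂ) - ω * Complex.I ≠ 0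
        ∧ (c : ℂ) ^ 2 + ω ^ 2 ≠ 0 := by
      intro c hc
      refine ⟨fun h => ?_, fun h => ?_, ?_⟩
      · have := congrArg Complex.re h; simp at this; linarith
      · have := congrArg Complex.re h; simp at this; linarith
      · norm_cast; positivity
    have f1 : ∀ {c : ℝ}, 0 < c → 1 / ((c : ℂ) - ω * Complex.I)
        = (c + ω * Complex.I) / ((c : ℂ) ^ 2 + ω ^ 2) := by
      intro c hc
      rw [div_eq_div_iff (hne hc).1 (hne hc).2.2]
      linear_combination ((ω : ℂ) ^ 2) * Complex.I_sq
    have f2 : ∀ {c : ℝ}, 0 < c → -1 / (((-c : ℝ) : ℂ) - ω * Complex.I)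
        = (c - ω * Complex.I) / ((c : ℂ) ^ 2 + ω ^ 2) := by
      intro c hc
      rw [div_eq_div_iff (hne hc).2.1 (hne hc).2.2]
      push_cast
      linear_combination (-(ω : ℂ) ^ 2) * Complex.I_sq
    rw [f1 hμ, f1 hν, f2 hμ, f2 hν]
    push_cast
    have h1 := (hne hμ).2.2
    have h2 := (hne hν).2.2
    push_cast at h2
    generalize (μ : ℂ) ^ 2 + ω ^ 2 = A at *
    generalize ((μ : ℂ) + 2 * H) ^ 2 + ω ^ 2 = B at *
    linear_combination (-(a * ω / A : ℂ) + a * ω / B) * Complex.I_sq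

lemma isSpectralDensity_modExpKernel {H μ : ℝ} (a : ℝ) (hH : 0 < H) (hμ : 0 < μ) :
    IsSpectralDensity (modExpKernel H a μ) (fun x => modExpDensity H a μ (2 * π * x)) := by
  obtain ⟨h1, h2⟩ := fourier_modExpKernel a hH hμ
  have h3 : 𝓕 (modExpKernel H a μ) = fun x => (modExpDensity H a μ (2 * π * x) : ℂ) := funext h2
  have hi := integrable_modExpDensity a hH hμ
  refine ⟨hi, fun v => ?_⟩
  have h4 := (continuous_modExpKernel H a μ).fourierInv_fourier_eq h1 (h3 ▸ hi.ofReal)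
  rw [← congrFun h4 v, h3, Real.fourierInv_eq']
  congr 1 with x
  rw [smul_eq_mul, mul_comm]
  congr 4
  simp; ring

/-- The product `∏_{j=1}^{n} (1 - α / j)`, that is `(-1)^n` times the binomial coefficient
`α - 1` choose `n`. -/
noncomputable def altBinom (α : ℝ) (n : ℕ) : ℝ :=
  ∏ j ∈ Finset.range n, (1 - α / (j + 1))

@[simp]
lemma altBinom_zero (α : ℝ) : altBinom α 0 = 1 := by simp [altBinom]

lemma altBinom_succ (α : ℝ) (n : ℕ) :
    altBinom α (n + 1) = altBinom α n * (1 - α / (n + 1)) := by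
  simp [altBinom, Finset.prod_range_succ]

lemma sub_mul_altBinom_add_one (α : ℝ) (n : ℕ) :
    (n - α) * altBinom (α + 1) n = -α * altBinom α n := by
  induction n with
  | zero => simp
  | succ n ih =>
    have h : (n : ℝ) + 1 ≠ 0 := by positivity
    rw [altBinom_succ, altBinom_succ, ← mul_assoc (-α), ← ih]
    push_cast
    field_simp
    ring

lemma sum_altBinom_add_one (α : ℝ) (n : ℕ) :
    ∑ k ∈ Finset.range (n + 1), altBinom (α + 1) k = altBinom α n := by
  induction n with
  | zero => simp
  | succ n ih =>
    have h : (n : ℝ) + 1 ≠ 0 := by positivity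
    have h1 := sub_mul_altBinom_add_one α n
    rw [Finset.sum_range_succ, ih, altBinom_succ, altBinom_succ]
    field_simp
    linear_combination h1

lemma tendsto_altBinom {α : ℝ} (h0 : 0 < α) (h2 : α < 2) :
    Filter.Tendsto (altBinom α) Filter.atTop (nhds 0) := by
  set γ := min α 1 with hγ
  have hγ0 : 0 < γ := lt_min h0 one_pos
  have hγ1 : γ ≤ 1 := min_le_right _ _
  have hγα : γ ≤ α := min_le_left _ _
  have hb : ∀ n : ℕ, |altBinom α n|
      ≤ Real.exp (γ - γ * ∑ j ∈ Finset.range n, 1 / ((j : ℝ) + 1)) := by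
    intro n
    induction n with
    | zero => simpa using hγ0.le
    | succ n ih =>
      rcases Nat.eq_zero_or_pos n with rfl | hn
      · simp only [altBinom, Nat.cast_zero, zero_add, Finset.range_one, Finset.prod_singleton,
          Finset.sum_singleton, div_one, mul_one, sub_self, Real.exp_zero]
        exact abs_le.2 ⟨by linarith, by linarith⟩
      · have hn' : (1 : ℝ) ≤ n := by exact_mod_cast hn
        have hle : α / (n + 1) ≤ 1 := by rw [div_le_one (by positivity)]; linarith
        have hf : |1 - α / (n + 1)| ≤ Real.exp (-(γ * (1 / ((n : ℝ) + 1)))) := by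
          rw [abs_of_nonneg (by linarith)]
          refine le_trans ?_ (Real.one_sub_le_exp_neg _)
          rw [mul_one_div]
          gcongr
        rw [altBinom_succ, abs_mul, Finset.sum_range_succ,
          show γ - γ * (∑ j ∈ Finset.range n, 1 / ((j : ℝ) + 1) + 1 / ((n : ℝ) + 1))
            = (γ - γ * ∑ j ∈ Finset.range n, 1 / ((j : ℝ) + 1)) + -(γ * (1 / ((n : ℝ) + 1)))
            by ring, Real.exp_add]
        gcongr
  refine squeeze_zero_norm hb ?_
  refine Real.tendsto_exp_atBot.comp ?_
  refine Filter.tendsto_atBot_add_const_left _ γ ?_ |>.congr fun n => (sub_eq_add_neg _ _).symm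
  exact Filter.tendsto_neg_atTop_atBot.comp
    (Real.tendsto_sum_range_one_div_nat_succ_atTop.const_mul_atTop hγ0)

lemma altBinom_add_one_eq_choose (α : ℝ) (n : ℕ) :
    altBinom (α + 1) n = (-1) ^ n * Ring.choose α n := by
  have hrec : ∀ k : ℕ, ((k : ℝ) + 1) * Ring.choose α (k + 1) = (α - k) * Ring.choose α k := by
    intro k
    have h1 := Ring.descPochhammer_eq_factorial_smul_choose α (k + 1)
    have h2 := Ring.descPochhammer_eq_factorial_smul_choose α k
    rw [descPochhammer_succ_right, Polynomial.smeval_mul, h2, Polynomial.smeval_sub,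
      Polynomial.smeval_X, Polynomial.smeval_natCast] at h1
    have hk : (k.factorial : ℝ) ≠ 0 := by positivity
    simp only [nsmul_eq_mul, Nat.factorial_succ, pow_one, pow_zero, mul_one] at h1
    push_cast at h1
    apply mul_left_cancel₀ hk
    linear_combination -h1
  induction n with
  | zero => simp
  | succ n ih =>
    have h : (n : ℝ) + 1 ≠ 0 := by positivity
    rw [altBinom_succ, ih, pow_succ]
    field_simp
    linear_combination hrec n

lemma hasSum_altBinom_mul_pow {y : ℝ} (α : ℝ) (h0 : 0 ≤ y) (h1 : y < 1) :
    HasSum (fun n => altBinom (α + 1) n * y ^ n) ((1 - y) ^ α) := by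
  have h := (Real.one_add_rpow_hasFPowerSeriesOnBall_zero (a := α)).hasSum (y := -y)
    (by simpa [← ofReal_norm, abs_of_nonneg h0] using h1)
  rw [zero_add, ← sub_eq_add_neg] at h
  refine h.congr_fun fun n => ?_
  rw [altBinom_add_one_eq_choose, binomialSeries_apply]
  simp only [List.ofFn_const, List.prod_replicate, smul_eq_mul, neg_pow y]
  ring

/-- The partial sums of the binomial series converge on all of `[0, 1]`. -/
lemma tendsto_sum_altBinom_mul_pow {α y : ℝ} (hα : 0 < α) (hα2 : α < 2) (h0 : 0 ≤ y)
    (h1 : y ≤ 1) :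
    Filter.Tendsto (fun N => ∑ k ∈ Finset.range N, altBinom (α + 1) (k + 1) * y ^ (k + 1))
      Filter.atTop (nhds ((1 - y) ^ α - 1)) := by
  have key : Filter.Tendsto (fun N => ∑ k ∈ Finset.range (N + 1), altBinom (α + 1) k * y ^ k)
      Filter.atTop (nhds ((1 - y) ^ α)) := by
    rcases h1.lt_or_eq with h | rfl
    · exact ((hasSum_altBinom_mul_pow α h0 h).tendsto_sum_nat).comp (Filter.tendsto_add_atTop_nat 1)
    · simpa [sum_altBinom_add_one, Real.zero_rpow hα.ne'] using tendsto_altBinom hα hα2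
  refine (key.sub_const 1).congr fun N => ?_
  rw [Finset.sum_range_succ']
  simp

lemma one_le_Gamma_of_mem_Ioc {x : ℝ} (hx : x ∈ Set.Ioc (0 : ℝ) 1) : 1 ≤ Real.Gamma x := by
  simpa using Real.Gamma_strictAntiOn_Ioc.antitoneOn hx ⟨one_pos, le_rfl⟩ hx.2

lemma Gamma_le_one_of_mem_Icc {x : ℝ} (hx : x ∈ Set.Icc (1 : ℝ) 2) : Real.Gamma x ≤ 1 := by
  have h := Real.convexOn_Gamma.2 (Set.mem_Ioi.2 one_pos) (Set.mem_Ioi.2 two_pos)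
    (show 0 ≤ 2 - x by linarith [hx.2]) (show 0 ≤ x - 1 by linarith [hx.1]) (by ring)
  simp only [smul_eq_mul, Real.Gamma_one, Real.Gamma_two] at h
  rw [show (2 - x) * 1 + (x - 1) * 2 = x by ring] at h
  linarith

lemma sin_pi_mul_nonneg {H : ℝ} (h0 : 0 ≤ H) (h1 : H ≤ 1) : 0 ≤ Real.sin (π * H) :=
  Real.sin_nonneg_of_nonneg_of_le_pi (by positivity) (by nlinarith [Real.pi_pos])

lemma Gamma_two_mul_div_sq_le_one {H : ℝ} (h0 : 0 < H) (h1 : H ≤ 1 / 2) :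
    Real.Gamma (2 * H) / Real.Gamma H ^ 2 ≤ 1 := by
  have hG : 1 ≤ Real.Gamma H := one_le_Gamma_of_mem_Ioc ⟨h0, by linarith⟩
  have h := Real.Gamma_strictAntiOn_Ioc.antitoneOn (a := H) (b := 2 * H) ⟨h0, by linarith⟩
    ⟨by linarith, by linarith⟩ (by linarith)
  rw [div_le_one (by positivity)]
  nlinarith

lemma theta_bound_le_one {H : ℝ} (h0 : 0 < H) (h1 : H ≤ 1 / 2) :
    Real.Gamma (2 * H) / Real.Gamma H ^ 2 * ((1 - H) / (4 * H)) * Real.sin (π * H)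
      * Real.tanh (π * H) ≤ 1 := by
  have hR := Gamma_two_mul_div_sq_le_one h0 h1
  have hR0 : 0 ≤ Real.Gamma (2 * H) / Real.Gamma H ^ 2 := by
    have := Real.Gamma_pos_of_pos (show 0 < 2 * H by linarith)
    positivity
  have hs : (1 - H) / (4 * H) * Real.sin (π * H) ≤ 1 := by
    have h2 : Real.sin (π * H) ≤ 4 * H :=
      (Real.sin_le (by positivity)).trans (by nlinarith [Real.pi_le_four])
    rw [div_mul_eq_mul_div, div_le_one (by positivity)]
    nlinarith [sin_pi_mul_nonneg h0.le (by linarith)]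
  have hs0 : 0 ≤ (1 - H) / (4 * H) * Real.sin (π * H) :=
    mul_nonneg (div_nonneg (by linarith) (by positivity)) (sin_pi_mul_nonneg h0.le (by linarith))
  rw [mul_assoc (Real.Gamma (2 * H) / _)]
  refine (mul_le_of_le_one_right (mul_nonneg hR0 hs0) (Real.tanh_lt_one _).le).trans ?_
  exact mul_le_one₀ hR hs0 hs

lemma Gamma_ratio_mul_sin_le {H : ℝ} (h0 : 1 / 2 ≤ H) (h1 : H < 1) :
    Real.Gamma (2 * H) / Real.Gamma H ^ 2 * Real.sin (π * H) ≤ 4 / 5 := by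
  have hG : 1 ≤ Real.Gamma H := one_le_Gamma_of_mem_Ioc ⟨by linarith, h1.le⟩
  have hG' : Real.Gamma (H + 1 / 2) ≤ 1 := Gamma_le_one_of_mem_Icc ⟨by linarith, by linarith⟩
  have hdup := Real.Gamma_mul_Gamma_add_half H
  have hs0 := sin_pi_mul_nonneg (H := H) (by linarith) h1.le
  have hπ : 0 < √π := by positivity
  have hR : Real.Gamma (2 * H) / Real.Gamma H ^ 2 ≤ 2 ^ (2 * H - 1) / √π := by
    have h2 : (2 : ℝ) ^ (1 - 2 * H) * 2 ^ (2 * H - 1) = 1 := by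
      rw [← Real.rpow_add two_pos]; simp
    have h3 : Real.Gamma (2 * H) * √π
        = 2 ^ (2 * H - 1) * (Real.Gamma H * Real.Gamma (H + 1 / 2)) := by
      rw [hdup]; linear_combination (-Real.Gamma (2 * H) * √π) * h2
    rw [div_le_div_iff₀ (by positivity) hπ, h3]
    have : (0 : ℝ) < 2 ^ (2 * H - 1) := by positivity
    gcongr
    nlinarith
  have hsin : (2 : ℝ) ^ (2 * H - 1) * Real.sin (π * H) ≤ √2 := by
    rcases le_total H (3 / 4) with h | h
    · have h2 : (2 : ℝ) ^ (2 * H - 1) ≤ √2 := by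
        rw [Real.sqrt_eq_rpow]
        exact Real.rpow_le_rpow_of_exponent_le (by norm_num) (by linarith)
      exact (mul_le_mul h2 (Real.sin_le_one _) hs0 (by positivity)).trans (by simp)
    · have h2 : (2 : ℝ) ^ (2 * H - 1) ≤ 2 := by
        calc (2 : ℝ) ^ (2 * H - 1) ≤ 2 ^ (1 : ℝ) :=
              Real.rpow_le_rpow_of_exponent_le (by norm_num) (by linarith)
          _ = 2 := Real.rpow_one 2
      have h3 : Real.sin (π * H) ≤ √2 / 2 := by
        rw [← Real.sin_pi_div_four, ← Real.sin_pi_sub]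
        exact Real.sin_le_sin_of_le_of_le_pi_div_two (by nlinarith [Real.pi_pos])
          (by linarith [Real.pi_pos]) (by nlinarith [Real.pi_pos])
      nlinarith
  have hsq : √2 / √π ≤ 4 / 5 := by
    rw [← Real.sqrt_div zero_le_two, Real.sqrt_le_left (by norm_num), div_le_iff₀ Real.pi_pos]
    nlinarith [Real.pi_gt_d2]
  calc _ ≤ 2 ^ (2 * H - 1) / √π * Real.sin (π * H) := by gcongr
    _ = 2 ^ (2 * H - 1) * Real.sin (π * H) / √π := by ring
    _ ≤ √2 / √π := by gcongr
    _ ≤ 4 / 5 := hsq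

lemma two_mul_theta_bound_le {H : ℝ} (h0 : 1 / 2 ≤ H) (h1 : H < 1) :
    2 * H * (Real.Gamma (2 * H) / Real.Gamma H ^ 2 * ((1 - H) / (4 * H)) * Real.sin (π * H)
      * Real.tanh (π * H)) ≤ 2 / 5 * (1 - H) := by
  have hR := Gamma_ratio_mul_sin_le h0 h1
  have hR0 : 0 ≤ Real.Gamma (2 * H) / Real.Gamma H ^ 2 * Real.sin (π * H) := by
    have := Real.Gamma_pos_of_pos (show 0 < 2 * H by linarith)
    have := sin_pi_mul_nonneg (H := H) (by linarith) h1.le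
    positivity
  have hH : H ≠ 0 := by linarith
  calc _ = (1 - H) / 2 * (Real.Gamma (2 * H) / Real.Gamma H ^ 2 * Real.sin (π * H)
        * Real.tanh (π * H)) := by field_simp; ring
    _ ≤ (1 - H) / 2 * (4 / 5) := by
        refine mul_le_mul_of_nonneg_left ?_ (by linarith)
        exact (mul_le_of_le_one_right hR0 (Real.tanh_lt_one _).le).trans hR
    _ = _ := by ring

lemma abs_two_mul_sinh_half_rpow (H v : ℝ) :
    |2 * Real.sinh (v / 2)| ^ (2 * H)
      = Real.exp (H * |v|) * (1 - Real.exp (-|v|)) ^ (2 * H) := by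
  have h1 : 0 ≤ 1 - Real.exp (-|v|) := by simp
  have h2 : |2 * Real.sinh (v / 2)| = Real.exp (|v| / 2) * (1 - Real.exp (-|v|)) := by
    rw [abs_mul, Real.abs_sinh, abs_two, abs_div, abs_two, Real.sinh_eq, mul_sub, mul_one,
      ← Real.exp_add]
    ring_nf
  rw [h2, Real.mul_rpow (Real.exp_pos _).le h1, ← Real.exp_mul]
  ring_nf

lemma tendsto_Ffun {H : ℝ} (h0 : 0 < H) (h1 : H < 1) (v : ℝ) :
    Filter.Tendsto (fun N => Real.exp (-(H * |v|)) + ∑ k ∈ Finset.range N,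
      -altBinom (2 * H + 1) (k + 1) * Real.exp (-((k + 1 - H) * |v|)))
      Filter.atTop (nhds (Ffun H v)) := by
  have h := tendsto_sum_altBinom_mul_pow (α := 2 * H) (by linarith) (by linarith)
    (Real.exp_pos (-|v|)).le (by simp)
  have hF : Ffun H v = Real.exp (-(H * |v|))
      + -Real.exp (H * |v|) * ((1 - Real.exp (-|v|)) ^ (2 * H) - 1) := by
    rw [Ffun, abs_two_mul_sinh_half_rpow, ← Real.cosh_abs, abs_mul, abs_of_pos h0, Real.cosh_eq]
    ring
  rw [hF]
  refine ((h.const_mul (-Real.exp (H * |v|))).const_add _).congr fun N => ?_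
  rw [Finset.mul_sum]
  congr 1
  refine Finset.sum_congr rfl fun k _ => ?_
  rw [show -((k + 1 - H) * |v|) = H * |v| + ((k + 1 : ℕ) : ℝ) * -|v| by push_cast; ring,
    Real.exp_add, Real.exp_nat_mul]
  ring

/-- The function `F_H` modulated by `1 + i a e^{-H|v|} sinh (H v)`. -/
noncomputable def modFfun (H a v : ℝ) : ℂ :=
  (Ffun H v : ℂ) * (1 + ((a * (Real.exp (-(H * |v|)) * Real.sinh (H * v)) : ℝ) : ℂ) * Complex.I)

lemma tendsto_modFfun {H : ℝ} (a : ℝ) (h0 : 0 < H) (h1 : H < 1) (v : ℝ) :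
    Filter.Tendsto (fun N => modExpKernel H a H v + ∑ k ∈ Finset.range N,
      ((-altBinom (2 * H + 1) (k + 1) : ℝ) : ℂ) * modExpKernel H a (k + 1 - H) v)
      Filter.atTop (nhds (modFfun H a v)) := by
  have h := ((Complex.continuous_ofReal.tendsto _).comp (tendsto_Ffun h0 h1 v)).mul_const
    (1 + ((a * (Real.exp (-(H * |v|)) * Real.sinh (H * v)) : ℝ) : ℂ) * Complex.I)
  refine h.congr fun N => ?_
  simp only [Function.comp_apply, Complex.ofReal_add, Complex.ofReal_sum, add_mul, Finset.sum_mul]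
  congr 1
  refine Finset.sum_congr rfl fun k _ => ?_
  rw [modExpKernel, Complex.ofReal_mul, mul_assoc]

lemma modExpDensity_nonneg {H a μ : ℝ} (hH : 0 < H) (hμ : H ≤ μ) (ha : |a| ≤ 1) (ω : ℝ) :
    0 ≤ modExpDensity H a μ ω := by
  have hμ0 : 0 < μ := hH.trans_le hμ
  have hA : 0 < μ ^ 2 + ω ^ 2 := by positivity
  have hB : 0 < (μ + 2 * H) ^ 2 + ω ^ 2 := by positivity
  have hd : modExpDensity H a μ ω
      = (2 * μ + a * (4 * H * (μ + H)) * (ω / ((μ + 2 * H) ^ 2 + ω ^ 2))) / (μ ^ 2 + ω ^ 2) := by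
    rw [modExpDensity]
    field_simp
    ring
  rw [hd]
  refine div_nonneg ?_ hA.le
  have h1 : |a * (4 * H * (μ + H)) * (ω / ((μ + 2 * H) ^ 2 + ω ^ 2))| ≤ 2 * μ := by
    rw [abs_mul, abs_mul, abs_of_pos (show 0 < 4 * H * (μ + H) by positivity)]
    calc _ ≤ 1 * (4 * H * (μ + H)) * (1 / (2 * (μ + 2 * H))) := by
          gcongr
          exact abs_div_sq_add_sq_le (by positivity) ω
      _ = 2 * H * ((μ + H) / (μ + 2 * H)) := by field_simp; ring
      _ ≤ 2 * H * 1 := by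
          gcongr
          rw [div_le_one (by positivity)]
          linarith
      _ ≤ 2 * μ := by linarith
  linarith [neg_abs_le (a * (4 * H * (μ + H)) * (ω / ((μ + 2 * H) ^ 2 + ω ^ 2)))]

lemma altBinom_succ_nonpos {H : ℝ} (h0 : 0 ≤ H) (h1 : H ≤ 1 / 2) (k : ℕ) :
    altBinom (2 * H + 1) (k + 1) ≤ 0 := by
  induction k with
  | zero => simp [altBinom_succ]; linarith
  | succ k ih =>
    rw [altBinom_succ]
    refine mul_nonpos_of_nonpos_of_nonneg ih ?_
    rw [sub_nonneg, div_le_one (by positivity)]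
    push_cast
    linarith [(Nat.cast_nonneg k : (0 : ℝ) ≤ k)]

lemma isPosDefFun_modFfun_of_le_half {H a : ℝ} (h0 : 0 < H) (h1 : H ≤ 1 / 2) (ha : |a| ≤ 1) :
    IsPosDefFun (modFfun H a) := by
  have hk : ∀ k : ℕ, H ≤ k + 1 - H := fun k => by
    linarith [(Nat.cast_nonneg k : (0 : ℝ) ≤ k)]
  refine IsPosDefFun.of_tendsto (fun N => ?_) (tendsto_modFfun a h0 (by linarith))
  refine ((isSpectralDensity_modExpKernel a h0 h0).add (IsSpectralDensity.sum (fun k : ℕ =>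
    (isSpectralDensity_modExpKernel a h0 (h0.trans_le (hk k))).const_mul
      (-altBinom (2 * H + 1) (k + 1))) N)).isPosDefFun fun x => ?_
  refine add_nonneg (modExpDensity_nonneg h0 le_rfl ha _) (Finset.sum_nonneg fun k _ => ?_)
  exact mul_nonneg (neg_nonneg.2 (altBinom_succ_nonpos h0.le h1 k))
    (modExpDensity_nonneg h0 (hk k) ha _)

/-- The rational function describing the odd part of the spectral density of
`l e^{-H|v|} - H e^{-l|v|}` after modulation. -/
noncomputable def oddRatio (H l x : ℝ) : ℝ :=
  (x ^ 4 + (4 * l ^ 2 + 12 * l * H + 10 * H ^ 2) * x ^ 2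
    + (2 * l ^ 4 + 10 * l ^ 3 * H + 18 * l ^ 2 * H ^ 2 + 18 * l * H ^ 3 + 9 * H ^ 4))
    / ((9 * H ^ 2 + x ^ 2) * ((l + 2 * H) ^ 2 + x ^ 2))

lemma oddRatio_nonneg {H l : ℝ} (hH : 0 < H) (hl : 0 < l) (x : ℝ) : 0 ≤ oddRatio H l x := by
  unfold oddRatio; positivity

lemma oddRatio_abs (H l x : ℝ) : oddRatio H l |x| = oddRatio H l x := by
  have h4 : |x| ^ 4 = x ^ 4 := by rw [show (4 : ℕ) = 2 * 2 by norm_num, pow_mul, sq_abs, ← pow_mul]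
  simp only [oddRatio, sq_abs, h4]

lemma oddRatio_le_of_le {H l : ℝ} (hl : 0 < l) (hlH : l ≤ H) (x : ℝ) :
    oddRatio H l x ≤ 4 / 3 := by
  have hH : 0 < H := hl.trans_le hlH
  rw [oddRatio, div_le_iff₀ (by positivity)]
  obtain ⟨t, rfl⟩ : ∃ t, H = l + t := ⟨H - l, by ring⟩
  have ht : 0 ≤ t := by linarith
  have h2 : 0 ≤ (x ^ 2 - 3 * l ^ 2) ^ 2 := sq_nonneg _
  have h3 : 0 ≤ t * l * x ^ 2 := by positivity
  have h4 : 0 ≤ t ^ 2 * x ^ 2 := by positivity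
  have h5 : 0 ≤ t * l ^ 3 := by positivity
  have h6 : 0 ≤ t ^ 2 * l ^ 2 := by positivity
  have h7 : 0 ≤ t ^ 3 * l := by positivity
  have h8 : 0 ≤ t ^ 4 := by positivity
  have h9 : 0 ≤ l ^ 4 := by positivity
  nlinarith

lemma mul_oddRatio_le {H l x : ℝ} (hH : 1 / 2 ≤ H) (hl : 1 ≤ l) (hx : 0 ≤ x) :
    x * oddRatio H l x ≤ 2 * l * (l + H) + x := by
  have hl0 : 0 < l := by linarith
  have hH0 : 0 < H := by linarith
  rw [oddRatio, mul_div_assoc', div_le_iff₀ (by positivity)]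
  have e1 : x ^ 3 * (3 * l ^ 2 + 8 * l * H)
      ≤ 2 * l * (l + H) * (3 / 4 * (x ^ 4 + (l + 2 * H) ^ 2 * x ^ 2)) := by
    have h1 : x * (3 * l + 8 * H) ≤ 3 / 2 * (l + H) * (x ^ 2 + (l + 2 * H) ^ 2) := by
      have h2 : 3 * l + 8 * H ≤ 3 * (l + H) * (l + 2 * H) := by nlinarith
      nlinarith [mul_le_mul_of_nonneg_left h2 hx,
        mul_nonneg (add_pos hl0 hH0).le (sq_nonneg (x - (l + 2 * H)))]
    nlinarith [mul_le_mul_of_nonneg_left h1 (show 0 ≤ l * x ^ 2 by positivity)]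
  have e2 : l * (l + H) * (2 * l ^ 2 + 8 * l * H + H ^ 2) * x
      ≤ 2 * l * (l + H) * (9 * H ^ 2 * x ^ 2 + 1 / 4 * (l + 2 * H) ^ 2 * x ^ 2
        + 9 * H ^ 2 * (l + 2 * H) ^ 2) := by
    have h1 : (2 * l ^ 2 + 8 * l * H + H ^ 2) * x
        ≤ 2 * (9 * H ^ 2 * x ^ 2 + 1 / 4 * (l + 2 * H) ^ 2 * x ^ 2
          + 9 * H ^ 2 * (l + 2 * H) ^ 2) := by
      have h2 : 0 ≤ (l + 2 * H) ^ 2 * (x / 2 - 3 * H) ^ 2 := by positivity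
      have h3 : 0 ≤ (H - 1 / 2) * (x * (l + 2 * H) ^ 2) :=
        mul_nonneg (by linarith) (by positivity)
      have h4 : 0 ≤ x * l * H := by positivity
      have h5 : 0 ≤ x * l ^ 2 := by positivity
      have h6 : 0 ≤ x * H ^ 2 := by positivity
      have h7 : 0 ≤ H ^ 2 * x ^ 2 := by positivity
      nlinarith
    nlinarith [mul_le_mul_of_nonneg_left h1 (show 0 ≤ l * (l + H) by positivity)]
  have e3 : 0 ≤ 2 * l * (l + H) * (1 / 4 * x ^ 4) := by positivity
  have e4 : 0 ≤ 3 * H ^ 2 * x ^ 3 := by positivity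
  have e5 : 0 ≤ x * l * H ^ 3 := by positivity
  have e6 : 0 ≤ x * H ^ 4 := by positivity
  have e7 : 0 ≤ x * l ^ 2 * H ^ 2 := by positivity
  nlinarith

lemma weight_zero_ge {ε H b x : ℝ} (hε : 0 < ε) (hεH : ε ≤ H) (hb : 0 ≤ b) (hx : 0 ≤ x) :
    (ε - 4 / 3 * b * x) / (ε ^ 2 + x ^ 2) ≤ (ε - b * x * oddRatio H ε x) / (ε ^ 2 + x ^ 2) := by
  refine div_le_div_of_nonneg_right ?_ (by positivity)
  nlinarith [mul_le_mul_of_nonneg_left (oddRatio_le_of_le hε hεH x) (mul_nonneg hb hx)]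

lemma weight_ge {H l b x : ℝ} (hH : 1 / 2 ≤ H) (hl : 1 ≤ l) (hb : 0 ≤ b)
    (hx : 0 ≤ x) :
    (l * (1 - 2 * b) - b * x / (l + H)) / (l ^ 2 + x ^ 2)
      ≤ (l - b * x / (l + H) * oddRatio H l x) / (l ^ 2 + x ^ 2) := by
  have hlH : 0 < l + H := by linarith
  have h : b * x / (l + H) * oddRatio H l x ≤ b * (2 * l + x / (l + H)) := by
    calc _ = b / (l + H) * (x * oddRatio H l x) := by ring
      _ ≤ b / (l + H) * (2 * l * (l + H) + x) := by
          gcongr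
          exact mul_oddRatio_le hH hl hx
      _ = _ := by field_simp
  have h2 : b * (2 * l + x / (l + H)) = 2 * l * b + b * x / (l + H) := by ring
  refine div_le_div_of_nonneg_right ?_ (by positivity)
  linarith

/-- A Chebyshev-type sum inequality: weights `c` monotone, summand `q` changing sign at most once,
from negative to nonnegative. -/
lemma exists_mul_le_mul_of_monotone {c q : ℕ → ℝ} (hc : Monotone c) (hq : Monotone q)
    (hex : ∃ k, 0 ≤ q k) :
    ∃ n, (∀ k, c n * q k ≤ c k * q k) ∧ ∀ k < n, q k < 0 := by
  classical
  refine ⟨Nat.find hex, fun k => ?_, fun k hk => not_le.1 (Nat.find_min hex hk)⟩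
  rcases lt_or_ge k (Nat.find hex) with h | h
  · exact mul_le_mul_of_nonpos_right (hc h.le) (not_le.1 (Nat.find_min hex h)).le
  · exact mul_le_mul_of_nonneg_right (hc h) ((Nat.find_spec hex).trans (hq h))

lemma altBinom_nonneg {p : ℝ} (h1 : p ≤ 1) (n : ℕ) : 0 ≤ altBinom p n := by
  refine Finset.prod_nonneg fun j _ => ?_
  rw [sub_nonneg, div_le_one (by positivity)]
  linarith [(Nat.cast_nonneg j : (0 : ℝ) ≤ j)]

lemma altBinom_le_one {p : ℝ} (h0 : 0 ≤ p) (h1 : p ≤ 1) (n : ℕ) : altBinom p n ≤ 1 := by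
  refine Finset.prod_le_one (fun j _ => ?_) fun j _ => ?_
  · rw [sub_nonneg, div_le_one (by positivity)]
    linarith [(Nat.cast_nonneg j : (0 : ℝ) ≤ j)]
  · linarith [div_nonneg h0 (show 0 ≤ (j : ℝ) + 1 by positivity)]

lemma monotone_mul_altBinom {p : ℝ} (h1 : p ≤ 1) :
    Monotone fun j : ℕ => (j + 1 : ℝ) * altBinom p (j + 1) := by
  refine monotone_nat_of_le_succ fun j => ?_
  have h : (j : ℝ) + 1 + 1 ≠ 0 := by positivity
  rw [altBinom_succ p (j + 1)]
  push_cast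
  have e : ((j : ℝ) + 1 + 1) * (altBinom p (j + 1) * (1 - p / (j + 1 + 1)))
      = (j + 2 - p) * altBinom p (j + 1) := by
    field_simp; ring
  rw [e]
  exact mul_le_mul_of_nonneg_right (by linarith) (altBinom_nonneg h1 _)

/-- The lower bound for the weights `weight_ge` divided by `k + 1`, summed over `k`. -/
lemma sum_weight_div_ge {ε b x : ℝ} (hε : 0 ≤ ε) (hε1 : ε ≤ 1) (hb : 0 ≤ b) (hb1 : b ≤ 1 / 2)
    (hx : 0 < x) (M : ℕ) :
    (1 - 2 * b) / (2 + x) - (1 - 2 * b) / (M + 2 + x) - b / x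
      ≤ ∑ j ∈ Finset.range M, ((j + 1 + ε) * (1 - 2 * b) - b * x / (j + 2))
          / ((j + 1 + ε) ^ 2 + x ^ 2) / (j + 1) := by
  have hstrong : (1 - 2 * b) / (2 + x) - (1 - 2 * b) / (M + 2 + x) - b / x * (1 - 1 / (M + 1))
      ≤ ∑ j ∈ Finset.range M, ((j + 1 + ε) * (1 - 2 * b) - b * x / (j + 2))
          / ((j + 1 + ε) ^ 2 + x ^ 2) / (j + 1) := by
    induction M with
    | zero => simp
    | succ n ih =>
      rw [Finset.sum_range_succ]
      have hn : (0 : ℝ) ≤ n := Nat.cast_nonneg n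
      have hτ : 0 ≤ 1 - 2 * b := by linarith
      have h1 : (1 - 2 * b) / ((n + 2 + x) * (n + 3 + x))
          ≤ (n + 1 + ε) * (1 - 2 * b) / ((n + 1 + ε) ^ 2 + x ^ 2) / (n + 1) := by
        rw [div_div, div_le_div_iff₀ (by positivity) (by positivity)]
        have : ((n + 1 + ε) ^ 2 + x ^ 2) * (n + 1)
            ≤ (n + 1 + ε) * ((n + 2 + x) * (n + 3 + x)) := by
          have h2 : (n + 1 + ε) ^ 2 + x ^ 2 ≤ (n + 2 + x) * (n + 3 + x) := by nlinarith
          calc _ ≤ ((n + 2 + x) * (n + 3 + x)) * (n + 1 + ε) :=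
                mul_le_mul h2 (by linarith) (by positivity) (by positivity)
            _ = _ := by ring
        nlinarith [mul_le_mul_of_nonneg_left this hτ]
      have h2 : b * x / (n + 2) / ((n + 1 + ε) ^ 2 + x ^ 2) / (n + 1)
          ≤ b / x * (1 / ((n + 1) * (n + 2))) := by
        calc _ ≤ b * x / (n + 2) / (0 + x ^ 2) / (n + 1) := by
              gcongr; positivity
          _ = _ := by field_simp; ring
      have h3 : (1 - 2 * b) / ((n + 2 + x) * (n + 3 + x))
          = (1 - 2 * b) / (n + 2 + x) - (1 - 2 * b) / (n + 1 + 2 + x) := by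
        field_simp; ring
      have h4 : b / x * (1 / (((n : ℝ) + 1) * (n + 2)))
          = b / x * (1 - 1 / (n + 1 + 1)) - b / x * (1 - 1 / (n + 1)) := by
        field_simp; ring
      rw [sub_div _ (b * x / _), sub_div _ (b * x / _ / _)]
      push_cast
      linarith
  refine le_trans ?_ hstrong
  have : b / x * (1 - 1 / ((M : ℝ) + 1)) ≤ b / x :=
    mul_le_of_le_one_right (by positivity) (by simp; positivity)
  linarith

/-- The sum over the high frequencies, up to a tail which vanishes uniformly in `x`. -/
lemma sum_altBinom_mul_weight_ge {ε b x : ℝ} (hε : 0 < ε) (hε2 : ε ≤ 1 / 2) (hb : 0 ≤ b)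
    (hb2 : b ≤ 1 / 5) (hx : 1 ≤ x) (M : ℕ) :
    2 * ε * ((1 - 2 * b) / (2 + x) - b / x) - 1 / √(M + 1)
      ≤ ∑ j ∈ Finset.range M, altBinom (1 - 2 * ε) (j + 1) *
          (((j + 1 + ε) * (1 - 2 * b) - b * x / (j + 2)) / ((j + 1 + ε) ^ 2 + x ^ 2)) := by
  have hp : 1 - 2 * ε ≤ 1 := by linarith
  have hc := monotone_mul_altBinom hp
  set c : ℕ → ℝ := fun j => (j + 1 : ℝ) * altBinom (1 - 2 * ε) (j + 1) with hcdef
  set q : ℕ → ℝ := fun j => (j + 1 + ε) * (j + 2) * (1 - 2 * b) - b * x with hqdef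
  have hτ : 3 / 5 ≤ 1 - 2 * b := by linarith
  have hq : Monotone q := by
    intro i j hij
    have : (i : ℝ) ≤ j := by exact_mod_cast hij
    simp only [hqdef]
    gcongr
  obtain ⟨n, hn, hneg⟩ := exists_mul_le_mul_of_monotone hc hq (by
    obtain ⟨k, hk⟩ := exists_nat_ge x
    refine ⟨k, ?_⟩
    have h1 : x * 1 ≤ (k + 1 + ε) * (k + 2) := by
      gcongr <;> linarith
    simp only [hqdef]
    nlinarith)
  have hc0 : 2 * ε ≤ c n := by
    refine le_trans ?_ (hc (Nat.zero_le n))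
    simp [hcdef, altBinom_succ]
  have hcn : c n ≤ n + 1 := mul_le_of_le_one_right (by positivity)
    (altBinom_le_one (by linarith) hp _)
  have hcx : c n ^ 2 ≤ x := by
    rcases Nat.eq_zero_or_pos n with h0 | h0
    · have : c n ≤ 1 := by simpa [h0] using hcn
      nlinarith
    · obtain ⟨k, rfl⟩ : ∃ k, n = k + 1 := ⟨n - 1, by omega⟩
      have h1 := hneg k (Nat.lt_succ_self k)
      have hk : (0 : ℝ) ≤ k := Nat.cast_nonneg k
      simp only [hqdef] at h1
      push_cast at hcn
      have h2 : c (k + 1) ^ 2 ≤ (k + 2) ^ 2 := by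
        gcongr
        · linarith
        · linarith
      have h3 : (k + 1) * (k + 2) * (3 / 5) ≤ (k + 1 + ε) * (k + 2) * (1 - 2 * b) := by
        have h5 : (k : ℝ) + 1 ≤ k + 1 + ε := by linarith
        gcongr
      have h4 : b * x ≤ 1 / 5 * x := by gcongr
      nlinarith
  have hterm : ∀ j : ℕ, c n * (((j + 1 + ε) * (1 - 2 * b) - b * x / (j + 2))
      / ((j + 1 + ε) ^ 2 + x ^ 2) / (j + 1)) ≤ altBinom (1 - 2 * ε) (j + 1) *
          (((j + 1 + ε) * (1 - 2 * b) - b * x / (j + 2)) / ((j + 1 + ε) ^ 2 + x ^ 2)) := by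
    intro j
    have hpos : 0 < ((j : ℝ) + 1) * (j + 2) * ((j + 1 + ε) ^ 2 + x ^ 2) := by positivity
    calc _ = c n * q j / (((j : ℝ) + 1) * (j + 2) * ((j + 1 + ε) ^ 2 + x ^ 2)) := by
          simp only [hqdef]; field_simp
      _ ≤ c j * q j / (((j : ℝ) + 1) * (j + 2) * ((j + 1 + ε) ^ 2 + x ^ 2)) := by
          exact div_le_div_of_nonneg_right (hn j) hpos.le
      _ = _ := by simp only [hqdef, hcdef]; field_simp
  refine le_trans ?_ (Finset.sum_le_sum fun j _ => hterm j)
  rw [← Finset.mul_sum]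
  have hsum := sum_weight_div_ge hε.le (by linarith) hb (by linarith) (by linarith : 0 < x) M
  have hq0 : 0 ≤ (1 - 2 * b) / (2 + x) - b / x := by
    rw [sub_nonneg, div_le_div_iff₀ (by positivity) (by positivity)]
    nlinarith
  have hm0 : 0 ≤ c n := by linarith
  have htail : c n * ((1 - 2 * b) / (M + 2 + x)) ≤ 1 / √(M + 1) := by
    have hs : 0 < √((M : ℝ) + 1) := by positivity
    have hs2 : √((M : ℝ) + 1) ^ 2 = M + 1 := Real.sq_sqrt (by positivity)
    calc _ ≤ c n * (1 / (M + 2 + x)) := by gcongr; linarith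
      _ ≤ 1 / √(M + 1) := by
          rw [mul_one_div, div_le_div_iff₀ (by positivity) hs]
          nlinarith [sq_nonneg (c n - √((M : ℝ) + 1))]
  have h1 := mul_le_mul_of_nonneg_left hsum hm0
  have h2 := mul_le_mul_of_nonneg_right hc0 hq0
  linarith

lemma weight_zero_add_nonneg {ε b x : ℝ} (hε : 0 < ε) (hε2 : ε ≤ 1 / 2)
    (hbε : b ≤ 2 / 5 * ε) (hx : 1 ≤ x) :
    0 ≤ (ε - 4 / 3 * b * x) / (ε ^ 2 + x ^ 2) + 2 * ε * ((1 - 2 * b) / (2 + x) - b / x) := by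
  have hx0 : 0 < x := by linarith
  have h1 : (ε - 8 / 15 * ε * x) / x ^ 2 ≤ (ε - 4 / 3 * b * x) / (ε ^ 2 + x ^ 2) ∨
      0 ≤ (ε - 4 / 3 * b * x) / (ε ^ 2 + x ^ 2) := by
    rcases le_total 0 (ε - 4 / 3 * b * x) with h | h
    · right; positivity
    · left
      calc _ ≤ (ε - 4 / 3 * b * x) / x ^ 2 := by
            gcongr ?_ / _
            nlinarith
        _ ≤ _ := by
            rw [div_le_div_iff₀ (by positivity) (by positivity)]
            nlinarith [sq_nonneg ε]
  have hq : 3 / 5 / (2 + x) - 1 / 5 / x ≤ (1 - 2 * b) / (2 + x) - b / x := by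
    gcongr <;> linarith
  have hq' : 3 / 5 / (2 + x) - 1 / 5 / x = (2 * x - 2) / (5 * x * (2 + x)) := by
    field_simp; ring
  rcases h1 with h1 | h1
  · have h2 : 0 ≤ (ε - 8 / 15 * ε * x) / x ^ 2 + 2 * ε * (3 / 5 / (2 + x) - 1 / 5 / x) := by
      have e : (ε - 8 / 15 * ε * x) / x ^ 2 + 2 * ε * (3 / 5 / (2 + x) - 1 / 5 / x)
          = ε * (4 * x ^ 2 - 13 * x + 30) / (15 * x ^ 2 * (2 + x)) := by
        field_simp; ring
      rw [e]
      have : 0 ≤ 4 * x ^ 2 - 13 * x + 30 := by nlinarith [sq_nonneg (x - 13 / 8)]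
      positivity
    have := mul_le_mul_of_nonneg_left hq (show 0 ≤ 2 * ε by positivity)
    linarith
  · have h3 : 0 ≤ (1 - 2 * b) / (2 + x) - b / x := by
      refine le_trans ?_ hq
      rw [hq']
      exact div_nonneg (by linarith) (by positivity)
    have := mul_nonneg (show 0 ≤ 2 * ε by positivity) h3
    linarith

/-- The total weight is nonnegative up to a uniformly vanishing tail. -/
lemma sum_altBinom_mul_oddRatio_ge {H b x : ℝ} (hH : 1 / 2 ≤ H) (hH1 : H < 1) (hb : 0 ≤ b)
    (hbH : b ≤ 2 / 5 * (1 - H)) (hx : 0 ≤ x) (M : ℕ) :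
    -(1 / √(M + 1)) ≤ ∑ k ∈ Finset.range (M + 1), altBinom (2 * H - 1) k *
      (((k + 1 - H) - b * x / (k + 1) * oddRatio H (k + 1 - H) x)
        / ((k + 1 - H) ^ 2 + x ^ 2)) := by
  obtain ⟨ε, rfl⟩ : ∃ ε, H = 1 - ε := ⟨1 - H, by ring⟩
  rw [show 2 * (1 - ε) - 1 = 1 - 2 * ε by ring]
  have hε : 0 < ε := by linarith
  have h0 := weight_zero_ge hε (show ε ≤ 1 - ε by linarith) hb hx
  have hk : ∀ j ∈ Finset.range M, altBinom (1 - 2 * ε) (j + 1) *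
      (((j + 1 + ε) * (1 - 2 * b) - b * x / (j + 2)) / ((j + 1 + ε) ^ 2 + x ^ 2))
      ≤ altBinom (1 - 2 * ε) (j + 1) * (((((j + 1 : ℕ) : ℝ) + 1 - (1 - ε))
        - b * x / (((j + 1 : ℕ) : ℝ) + 1) * oddRatio (1 - ε) (((j + 1 : ℕ) : ℝ) + 1 - (1 - ε)) x)
        / ((((j + 1 : ℕ) : ℝ) + 1 - (1 - ε)) ^ 2 + x ^ 2)) := by
    intro j _
    refine mul_le_mul_of_nonneg_left ?_ (altBinom_nonneg (by linarith) _)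
    have h := weight_ge (l := j + 1 + ε) hH
      (by linarith [(Nat.cast_nonneg j : (0 : ℝ) ≤ j)]) hb hx
    rw [show (j : ℝ) + 1 + ε + (1 - ε) = j + 2 by ring] at h
    rw [show ((j + 1 : ℕ) : ℝ) + 1 - (1 - ε) = j + 1 + ε by push_cast; ring,
      show ((j + 1 : ℕ) : ℝ) + 1 = j + 2 by push_cast; ring]
    exact h
  have hsum := Finset.sum_le_sum hk
  rw [Finset.sum_range_succ']
  simp only [altBinom_zero, one_mul, Nat.cast_zero, zero_add, div_one, sub_sub_cancel]
  have hs : 0 ≤ 1 / √((M : ℝ) + 1) := by positivity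
  rcases le_total x 1 with h | h
  · have hw0 : 0 ≤ (ε - 4 / 3 * b * x) / (ε ^ 2 + x ^ 2) :=
      div_nonneg (by nlinarith) (by positivity)
    have hwk : 0 ≤ ∑ j ∈ Finset.range M, altBinom (1 - 2 * ε) (j + 1) *
        (((j + 1 + ε) * (1 - 2 * b) - b * x / (j + 2)) / ((j + 1 + ε) ^ 2 + x ^ 2)) := by
      refine Finset.sum_nonneg fun j _ => mul_nonneg (altBinom_nonneg (by linarith) _)
        (div_nonneg ?_ (by positivity))
      have h1 : b * x / (j + 2) ≤ b := by
        rw [div_le_iff₀ (by positivity)]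
        gcongr
        linarith [(Nat.cast_nonneg j : (0 : ℝ) ≤ j)]
      nlinarith [(Nat.cast_nonneg j : (0 : ℝ) ≤ j)]
    linarith
  · have h1 := sum_altBinom_mul_weight_ge hε (by linarith) hb (by linarith) h M
    have h2 := weight_zero_add_nonneg (b := b) hε (by linarith) (by linarith) h
    linarith

lemma mul_altBinom_two_mul_add_one (H : ℝ) (k : ℕ) :
    (k + 1) * (k + 1 - 2 * H) * altBinom (2 * H + 1) (k + 1)
      = 2 * H * (2 * H - 1) * altBinom (2 * H - 1) k := by
  have h1 := sub_mul_altBinom_add_one (2 * H) (k + 1)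
  have h2 := sub_mul_altBinom_add_one (2 * H - 1) k
  have hk : (k : ℝ) + 1 ≠ 0 := by positivity
  have h3 : altBinom (2 * H) (k + 1) * (k + 1) = altBinom (2 * H) k * (k + 1 - 2 * H) := by
    rw [altBinom_succ]; field_simp
  rw [sub_add_cancel] at h2
  push_cast at h1
  linear_combination (k + 1 : ℝ) * h1 - 2 * H * h3 - 2 * H * h2

lemma sum_altBinom_mul_sub {H : ℝ} (hH : 0 < H) (h1 : H < 1) (N : ℕ) :
    ∑ k ∈ Finset.range (N + 1), altBinom (2 * H + 1) (k + 1) / H * (k + 1 - H)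
      = 1 - altBinom (2 * H - 1) (N + 1) - altBinom (2 * H - 1) N := by
  induction N with
  | zero =>
    simp [altBinom_succ]
    field_simp
    ring
  | succ n ih =>
    have hn : (0 : ℝ) ≤ n := Nat.cast_nonneg n
    have h := mul_altBinom_two_mul_add_one H (n + 1)
    have hne : (n : ℝ) + 2 - 2 * H ≠ 0 := by linarith
    have hB : altBinom (2 * H + 1) (n + 1 + 1)
        = 2 * H * (2 * H - 1) * altBinom (2 * H - 1) n / ((n + 1) * (n + 2)) := by
      rw [altBinom_succ (2 * H - 1)] at h
      push_cast at h
      field_simp at h ⊢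
      apply mul_left_cancel₀ hne
      linear_combination h
    rw [Finset.sum_range_succ, ih, hB, altBinom_succ _ (n + 1), altBinom_succ _ n]
    push_cast
    field_simp
    ring

lemma mul_modExpDensity_sub {H l : ℝ} (hH : 0 < H) (hl : 0 < l) (a ω : ℝ) :
    l * modExpDensity H a H ω - H * modExpDensity H a l ω
      = 2 * H * (l ^ 2 - H ^ 2) / (H ^ 2 + ω ^ 2)
        * ((l + 2 * H * a * ω / (l + H) * oddRatio H l ω) / (l ^ 2 + ω ^ 2)) := by
  rw [modExpDensity, modExpDensity, oddRatio, show H + 2 * H = 3 * H by ring]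
  have h1 : (3 * H) ^ 2 + ω ^ 2 = 9 * H ^ 2 + ω ^ 2 := by ring
  rw [h1]
  have e1 : H ^ 2 + ω ^ 2 ≠ 0 := by positivity
  have e2 : l ^ 2 + ω ^ 2 ≠ 0 := by positivity
  have e3 : 9 * H ^ 2 + ω ^ 2 ≠ 0 := by positivity
  have e4 : (l + 2 * H) ^ 2 + ω ^ 2 ≠ 0 := by positivity
  have e5 : l + H ≠ 0 := by positivity
  field_simp
  ring

lemma sum_modExpDensity_ge {H a : ℝ} (hH : 1 / 2 ≤ H) (hH1 : H < 1)
    (ha : 2 * H * |a| ≤ 2 / 5 * (1 - H)) (ω : ℝ) (M : ℕ) :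
    -(2 * (2 * H - 1) * (1 / √(M + 1))) * (2 * H / (H ^ 2 + ω ^ 2))
      ≤ ∑ k ∈ Finset.range (M + 1), altBinom (2 * H + 1) (k + 1) / H *
        ((k + 1 - H) * modExpDensity H a H ω - H * modExpDensity H a (k + 1 - H) ω) := by
  have hH0 : 0 < H := by linarith
  have hk : ∀ k : ℕ, 0 < (k : ℝ) + 1 - H := fun k => by
    linarith [(Nat.cast_nonneg k : (0 : ℝ) ≤ k)]
  have h := sum_altBinom_mul_oddRatio_ge hH hH1 (b := 2 * H * |a|) (by positivity) ha
    (abs_nonneg ω) M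
  have hc : 0 ≤ 4 * H * (2 * H - 1) / (H ^ 2 + ω ^ 2) :=
    div_nonneg (mul_nonneg (by positivity) (by linarith)) (by positivity)
  calc _ = 4 * H * (2 * H - 1) / (H ^ 2 + ω ^ 2) * -(1 / √(M + 1)) := by ring
    _ ≤ _ := mul_le_mul_of_nonneg_left h hc
    _ ≤ _ := by
      rw [Finset.mul_sum]
      refine Finset.sum_le_sum fun k _ => ?_
      have hB := mul_altBinom_two_mul_add_one H k
      have e : altBinom (2 * H + 1) (k + 1) / H *
          ((k + 1 - H) * modExpDensity H a H ω - H * modExpDensity H a (k + 1 - H) ω)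
          = 4 * H * (2 * H - 1) / (H ^ 2 + ω ^ 2) * (altBinom (2 * H - 1) k *
            (((k + 1 - H) + 2 * H * a * ω / (k + 1) * oddRatio H (k + 1 - H) ω)
              / ((k + 1 - H) ^ 2 + ω ^ 2))) := by
        rw [mul_modExpDensity_sub hH0 (hk k), sub_add_cancel]
        generalize ((k + 1 - H) + 2 * H * a * ω / (k + 1) * oddRatio H (k + 1 - H) ω)
              / ((k + 1 - H) ^ 2 + ω ^ 2) = W
        have : H ^ 2 + ω ^ 2 ≠ 0 := by positivity
        field_simp
        linear_combination 2 * W * hB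
      rw [e]
      refine mul_le_mul_of_nonneg_left (mul_le_mul_of_nonneg_left ?_
        (altBinom_nonneg (by linarith) _)) hc
      rw [oddRatio_abs, sq_abs]
      refine div_le_div_of_nonneg_right ?_ (by positivity)
      have h1 : 2 * H * a * ω / (k + 1) = 2 * H / (k + 1) * (a * ω) := by ring
      have h2 : 2 * H * |a| * |ω| / (k + 1) = 2 * H / (k + 1) * |a * ω| := by
        rw [abs_mul]; ring
      rw [h1, h2, sub_eq_add_neg, ← neg_mul, ← mul_neg]
      have := neg_abs_le (a * ω)
      have := oddRatio_nonneg hH0 (hk k) ω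
      gcongr

lemma isPosDefFun_modFfun_of_half_lt {H a : ℝ} (hH : 1 / 2 < H) (hH1 : H < 1)
    (ha : 2 * H * |a| ≤ 2 / 5 * (1 - H)) : IsPosDefFun (modFfun H a) := by
  have hH0 : 0 < H := by linarith
  have hk : ∀ k : ℕ, 0 < (k : ℝ) + 1 - H := fun k => by
    linarith [(Nat.cast_nonneg k : (0 : ℝ) ≤ k)]
  set e : ℕ → ℝ := fun M => 2 * (2 * H - 1) * (1 / √(M + 1)) with hedef
  have he : Filter.Tendsto e Filter.atTop (nhds 0) := by
    have h1 : Filter.Tendsto (fun M : ℕ => √((M : ℝ) + 1)) Filter.atTop Filter.atTop :=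
      Real.tendsto_sqrt_atTop.comp
        (Filter.tendsto_atTop_add_const_right _ 1 tendsto_natCast_atTop_atTop)
    simpa [hedef] using h1.inv_tendsto_atTop.const_mul (2 * (2 * H - 1))
  set β : ℕ → ℝ := fun k => altBinom (2 * H + 1) (k + 1) / H with hβ
  refine IsPosDefFun.of_tendsto (K := fun M v =>
    (∑ k ∈ Finset.range (M + 1), (((β k * (k + 1 - H) : ℝ) : ℂ) * modExpKernel H a H v
      + ((-altBinom (2 * H + 1) (k + 1) : ℝ) : ℂ) * modExpKernel H a (k + 1 - H) v))
      + (e M : ℂ) * modExpKernel H 0 H v) (fun M => ?_) fun v => ?_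
  · refine ((IsSpectralDensity.sum (fun k : ℕ =>
      ((isSpectralDensity_modExpKernel a hH0 hH0).const_mul (β k * (k + 1 - H))).add
      ((isSpectralDensity_modExpKernel a hH0 (hk k)).const_mul
        (-altBinom (2 * H + 1) (k + 1)))) (M + 1)).add
      ((isSpectralDensity_modExpKernel 0 hH0 hH0).const_mul (e M))).isPosDefFun fun x => ?_
    have h := sum_modExpDensity_ge hH.le hH1 ha (2 * π * x) M
    have h0 : modExpDensity H 0 H (2 * π * x) = 2 * H / (H ^ 2 + (2 * π * x) ^ 2) := by
      simp [modExpDensity]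
    have hs : ∀ k : ℕ, β k * (k + 1 - H) * modExpDensity H a H (2 * π * x)
        + -altBinom (2 * H + 1) (k + 1) * modExpDensity H a (k + 1 - H) (2 * π * x)
        = altBinom (2 * H + 1) (k + 1) / H * ((k + 1 - H) * modExpDensity H a H (2 * π * x)
          - H * modExpDensity H a (k + 1 - H) (2 * π * x)) := by
      intro k
      simp only [hβ]
      field_simp
      ring
    simp only [hs, h0]
    simp only [hedef]
    linarith
  · have h1 : Filter.Tendsto (fun M => ∑ k ∈ Finset.range (M + 1), β k * (k + 1 - H))
        Filter.atTop (nhds 1) := by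
      simp only [hβ, sum_altBinom_mul_sub hH0 hH1]
      have hD := tendsto_altBinom (α := 2 * H - 1) (by linarith) (by linarith)
      simpa using ((hD.comp (Filter.tendsto_add_atTop_nat 1)).const_sub 1).sub hD
    have h2 := (tendsto_modFfun a hH0 hH1 v).comp (Filter.tendsto_add_atTop_nat 1)
    have h3 := ((Complex.continuous_ofReal.tendsto _).comp h1).mul_const (modExpKernel H a H v)
    have h4 := ((Complex.continuous_ofReal.tendsto _).comp he).mul_const (modExpKernel H 0 H v)
    have h5 := ((h3.add h2).sub_const (modExpKernel H a H v)).add h4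
    simp only [Complex.ofReal_one, one_mul, Complex.ofReal_zero, zero_mul, add_zero,
      add_sub_cancel_left] at h5
    refine h5.congr fun M => ?_
    simp only [Function.comp_apply, Finset.sum_add_distrib, Complex.ofReal_sum, Finset.sum_mul]
    ring

lemma isPosDefFun_modFfun {H a : ℝ} (hH : H ∈ Set.Ioo (0 : ℝ) 1)
    (ha : |a| ≤ Real.Gamma (2 * H) / Real.Gamma H ^ 2 * ((1 - H) / (4 * H)) * Real.sin (π * H)
      * Real.tanh (π * H)) : IsPosDefFun (modFfun H a) := by
  rcases le_or_gt H (1 / 2) with h | h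
  · exact isPosDefFun_modFfun_of_le_half hH.1 h (ha.trans (theta_bound_le_one hH.1 h))
  · refine isPosDefFun_modFfun_of_half_lt h hH.2 (le_trans ?_ (two_mul_theta_bound_le h.le hH.2))
    exact mul_le_mul_of_nonneg_left ha (by linarith [hH.1])

lemma re_modFfun_mul (H₁ H₂ a b v₁ v₂ : ℝ) :
    (modFfun H₁ a v₁ * modFfun H₂ b v₂).re = 4 * Rtheta H₁ H₂ (-(a * b)) v₁ v₂ := by
  rw [Rtheta, sub_eq_add_neg, Real.exp_add]
  simp only [modFfun, Complex.mul_re, Complex.mul_im, Complex.add_re, Complex.add_im,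
    Complex.ofReal_re, Complex.ofReal_im, Complex.one_re, Complex.one_im, Complex.I_re,
    Complex.I_im]
  ring

/-- The real part of the pointwise product of two positive definite functions is a positive
semidefinite kernel on the plane. -/
lemma IsPosDefFun.sum_mul_re_nonneg {K L : ℝ → ℂ} (hK : IsPosDefFun K) (hL : IsPosDefFun L)
    (n : ℕ) (v : Fin n → ℝ × ℝ) (c : Fin n → ℝ) :
    0 ≤ ∑ i, ∑ j, c i * c j * (K ((v i).1 - (v j).1) * L ((v i).2 - (v j).2)).re := by
  have h := ((hK n fun i => (v i).1).hadamard (hL n fun i => (v i).2)).dotProduct_mulVec_nonneg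
    (fun i => (c i : ℂ))
  have h2 := (Complex.le_def.1 h).1
  simp only [dotProduct, Matrix.mulVec, Matrix.hadamard_apply, Matrix.of_apply, Finset.mul_sum,
    Complex.re_sum, Pi.star_apply, RCLike.star_def, Complex.conj_ofReal, Complex.zero_re,
    Complex.re_ofReal_mul, Complex.re_mul_ofReal] at h2
  refine h2.trans_eq (Finset.sum_congr rfl fun i _ => Finset.sum_congr rfl fun j _ => by ring)

/-- If
`√|θ| < min_{i∈{1,2}} (Γ(2Hᵢ)/Γ(Hᵢ)²)((1 − Hᵢ)/(4Hᵢ)) sin(πHᵢ) tanh(πHᵢ)`, then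
the kernel `(u,v) ↦ R_θ(u − v)` is positive semidefinite on `ℝ² × ℝ²`. -/
theorem Rtheta_posSemidef_of_theta_small (H₁ H₂ : ℝ)
    (hH₁ : H₁ ∈ Set.Ioo (0:ℝ) 1) (hH₂ : H₂ ∈ Set.Ioo (0:ℝ) 1) (θ : ℝ)
    (hθ : Real.sqrt |θ| <
      min ((Real.Gamma (2 * H₁) / Real.Gamma H₁ ^ 2)
            * ((1 - H₁) / (4 * H₁)) * Real.sin (π * H₁) * Real.tanh (π * H₁))
          ((Real.Gamma (2 * H₂) / Real.Gamma H₂ ^ 2)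
            * ((1 - H₂) / (4 * H₂)) * Real.sin (π * H₂) * Real.tanh (π * H₂))) :
    ∀ (n : ℕ) (v : Fin n → ℝ × ℝ) (c : Fin n → ℝ),
      0 ≤ ∑ i : Fin n, ∑ j : Fin n,
        c i * c j * Rtheta H₁ H₂ θ ((v i).1 - (v j).1) ((v i).2 - (v j).2) := by
  intro n v c
  obtain ⟨h1, h2⟩ := lt_min_iff.1 hθ
  obtain ⟨b, hb, hab⟩ : ∃ b, |b| = √|θ| ∧ -(√|θ| * b) = θ := by
    have hs := Real.mul_self_sqrt (abs_nonneg θ)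
    rcases le_total 0 θ with h | h
    · refine ⟨-√|θ|, by simp, ?_⟩
      rw [abs_of_nonneg h] at hs ⊢
      linarith
    · refine ⟨√|θ|, by simp, ?_⟩
      rw [abs_of_nonpos h] at hs ⊢
      linarith
  have hpos := (isPosDefFun_modFfun (a := √|θ|) hH₁
    ((abs_of_nonneg (Real.sqrt_nonneg _)).trans_le h1.le)).sum_mul_re_nonneg
    (isPosDefFun_modFfun (a := b) hH₂ (hb.trans_le h2.le)) n v c
  simp only [re_modFfun_mul, hab, mul_left_comm _ (4 : ℝ), ← Finset.mul_sum] at hpos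
  linarith
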